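/- Let x₁ < x₂, let V₀, W : ℝ → ℝ be continuous on [x₁,x₂] with V₀(x) > 0 for all x ∈ [x₁,x₂], and let E, δ, δ', c' be real numbers with 0 < δ < E, 0 < δ' < (x₂−x₁)/4, c' > 0, such that min_{[x₁,x₂]} V₀ < E − δ and V₀(x) − (E + δ) ≥ c' whenever x ∈ [x₁, x₁+2δ'] ∪ [x₂−2δ', x₂]. For each positive integer ℓ set h_ℓ := (ℓ(ℓ+1))^{−1/2}. Then there exist a constant C > 0 and a positive integer L such that for every integer ℓ ≥ L there exist κ_ℓ ∈ [E−δ, E+δ] and a twice continuously differentiable function u_ℓ : ℝ → ℝ, not identically zero on [x₁,x₂], with u_ℓ(x₁) = u_ℓ(x₂) = 0, satisfying −h_ℓ² u_ℓ''(x) + (V₀(x) + h_ℓ² W(x)) u_ℓ(x) = κ_ℓ u_ℓ(x) on [x₁,x₂] and ∫_{x₁}^{x₁+δ'} (u_ℓ'(x)² + u_ℓ(x)²) dx + ∫_{x₂−δ'}^{x₂} (u_ℓ'(x)² + u_ℓ(x)²) dx ≤ C e^{−C√(ℓ(ℓ+1))} ∫_{x₁}^{x₂} u_ℓ(x)² dx.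 -/

import Mathlib

open Set MeasureTheory

lemma qe_mono {a b : ℝ} {f f' : ℝ → ℝ}
    (hf : ∀ x ∈ Icc a b, HasDerivWithinAt f (f' x) (Icc a b) x)
    (h0 : ∀ x ∈ Icc a b, 0 ≤ f' x) : MonotoneOn f (Icc a b) := by
  refine monotoneOn_of_hasDerivWithinAt_nonneg (convex_Icc a b)
    (fun x hx => (hf x hx).continuousWithinAt) (f' := f') ?_ ?_
  · intro x hx
    exact (hf x (interior_subset hx)).mono interior_subset
  · intro x hx
    exact h0 x (interior_subset hx)

lemma qe_right {a b : ℝ} {f : ℝ → ℝ} {d x : ℝ} (hx : x ∈ Ico a b)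
    (hf : HasDerivWithinAt f d (Icc a b) x) : HasDerivWithinAt f d (Ici x) x := by
  refine hf.mono_of_mem_nhdsWithin ?_
  exact Icc_mem_nhdsGE_of_mem hx

lemma qe_sin_sq_lip (x y : ℝ) : |Real.sin x ^ 2 - Real.sin y ^ 2| ≤ 2 * |x - y| := by
  have h1 : |Real.sin x - Real.sin y| ≤ |x - y| := by
    have := Real.lipschitzWith_sin.dist_le_mul x y
    simpa [Real.dist_eq] using this
  have h2 : |Real.sin x + Real.sin y| ≤ 2 := by
    rw [abs_le]
    constructor <;> linarith [Real.sin_le_one x, Real.sin_le_one y, Real.neg_one_le_sin x,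
      Real.neg_one_le_sin y]
  have : Real.sin x ^ 2 - Real.sin y ^ 2 = (Real.sin x + Real.sin y) * (Real.sin x - Real.sin y) := by
    ring
  rw [this, abs_mul]
  exact mul_le_mul h2 h1 (abs_nonneg _) (by norm_num)

/-- The Prüfer vector field. -/
noncomputable def qeF (q : ℝ) (t : ℝ) : ℝ := 1 + (q - 1) * Real.sin t ^ 2

lemma qeF_lip {q M : ℝ} (hq : |q| ≤ M) (x y : ℝ) :
    |qeF q x - qeF q y| ≤ 2 * (M + 1) * |x - y| := by
  have : qeF q x - qeF q y = (q - 1) * (Real.sin x ^ 2 - Real.sin y ^ 2) := by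
    unfold qeF; ring
  rw [this, abs_mul]
  have h1 : |q - 1| ≤ M + 1 := by
    rw [abs_le] at *; constructor <;> linarith
  have := mul_le_mul h1 (qe_sin_sq_lip x y) (abs_nonneg _) (by linarith [abs_nonneg q])
  linarith

lemma qeF_q (q p t : ℝ) : qeF q t - qeF p t = (q - p) * Real.sin t ^ 2 := by
  unfold qeF; ring

lemma qeF_mono {q p : ℝ} (h : q ≤ p) (t : ℝ) : qeF q t ≤ qeF p t := by
  have := qeF_q p q t
  nlinarith [mul_nonneg (sub_nonneg.2 h) (sq_nonneg (Real.sin t))]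

lemma qeF_bound {q M : ℝ} (hq : |q| ≤ M) (t : ℝ) : |qeF q t| ≤ M + 2 := by
  have h1 : |q - 1| ≤ M + 1 := by
    rw [abs_le] at *; constructor <;> linarith
  have h2 : |Real.sin t ^ 2| ≤ 1 := by
    rw [abs_of_nonneg (sq_nonneg _)]; exact Real.sin_sq_le_one t
  have h3 : |(q - 1) * Real.sin t ^ 2| ≤ M + 1 := by
    rw [abs_mul]
    calc _ ≤ (M + 1) * 1 := mul_le_mul h1 h2 (abs_nonneg _) (by linarith [abs_nonneg q])
      _ = _ := by ring
  unfold qeF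
  calc _ ≤ |(1:ℝ)| + |(q - 1) * Real.sin t ^ 2| := abs_add_le _ _
    _ ≤ _ := by rw [abs_one]; linarith

lemma qe_exists {a b : ℝ} (hab : a ≤ b) {q : ℝ → ℝ} (hq : ContinuousOn q (Icc a b)) {M : ℝ}
    (hM : ∀ x ∈ Icc a b, |q x| ≤ M) :
    ∃ θ : ℝ → ℝ, θ a = 0 ∧ ∀ x ∈ Icc a b, HasDerivWithinAt θ (qeF (q x) (θ x)) (Icc a b) x := by
  have hM0 : 0 ≤ M := (abs_nonneg _).trans (hM a ⟨le_rfl, hab⟩)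
  have hPL : IsPicardLindelof (fun t x => qeF (q t) x) (tmin := a) (tmax := b)
      ⟨a, ⟨le_rfl, hab⟩⟩ (0:ℝ) (Real.toNNReal ((M + 2) * (b - a))) 0 (Real.toNNReal (M + 2))
      (Real.toNNReal (2 * (M + 1))) := by
    constructor
    · intro t ht
      apply LipschitzWith.lipschitzOnWith
      apply LipschitzWith.of_dist_le_mul
      intro x y
      rw [Real.dist_eq, Real.dist_eq, Real.coe_toNNReal _ (by linarith)]
      exact qeF_lip (hM t ht) x y
    · intro x _
      unfold qeF
      fun_prop
    · intro t ht x _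
      rw [Real.coe_toNNReal _ (by linarith), Real.norm_eq_abs]
      exact qeF_bound (hM t ht) x
    · have : 0 ≤ (M + 2) * (b - a) := mul_nonneg (by linarith) (by linarith)
      rw [Real.coe_toNNReal _ (by linarith), Real.coe_toNNReal _ this]
      simp [hab]
  obtain ⟨θ, h1, h2⟩ := hPL.exists_eq_forall_mem_Icc_hasDerivWithinAt₀
  exact ⟨θ, h1, h2⟩

lemma qe_compare {a b : ℝ} {p q θ φ : ℝ → ℝ} {M : ℝ}
    (hM : ∀ x ∈ Icc a b, |p x| ≤ M) (hpq : ∀ x ∈ Icc a b, p x ≤ q x)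
    (hθ : ∀ x ∈ Icc a b, HasDerivWithinAt θ (qeF (p x) (θ x)) (Icc a b) x)
    (hφ : ∀ x ∈ Icc a b, HasDerivWithinAt φ (qeF (q x) (φ x)) (Icc a b) x)
    (h0 : θ a ≤ φ a) : ∀ x ∈ Icc a b, θ x ≤ φ x := by
  intro x hx
  have key : ∀ ε > 0, θ x - φ x ≤ ε * Real.exp ((2 * (M + 1) + 1) * (x - a)) := by
    intro ε hε
    refine image_le_of_deriv_right_lt_deriv_boundary' (a := a) (b := b)
      (f := fun x => θ x - φ x) (f' := fun x => qeF (p x) (θ x) - qeF (q x) (φ x))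
      (B := fun x => ε * Real.exp ((2 * (M + 1) + 1) * (x - a)))
      (B' := fun x => ε * (Real.exp ((2 * (M + 1) + 1) * (x - a)) * ((2 * (M + 1) + 1) * 1)))
      ?_ ?_ ?_ ?_ ?_ ?_ hx
    · exact fun y hy => ((hθ y hy).sub (hφ y hy)).continuousWithinAt
    · intro y hy
      exact qe_right hy ((hθ y (Ico_subset_Icc_self hy)).sub (hφ y (Ico_subset_Icc_self hy)))
    · simp; linarith
    · fun_prop
    · intro y hy
      exact (((((hasDerivAt_id y).sub_const a).const_mul _).exp).const_mul ε).hasDerivWithinAt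
    · intro y hy hyB
      have hy' := Ico_subset_Icc_self hy
      have hB : 0 < ε * Real.exp ((2 * (M + 1) + 1) * (y - a)) := by positivity
      have h1 := qeF_mono (hpq y hy') (φ y)
      have h2 := (le_abs_self _).trans (qeF_lip (hM y hy') (θ y) (φ y))
      change θ y - φ y = _ at hyB
      rw [hyB, abs_of_pos hB] at h2
      linarith
  by_contra hcon
  push Not at hcon
  have hE := Real.exp_pos ((2 * (M + 1) + 1) * (x - a))
  have := key ((θ x - φ x) / (2 * Real.exp ((2 * (M + 1) + 1) * (x - a))))
    (div_pos (by linarith) (by positivity))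
  rw [div_mul_eq_mul_div, le_div_iff₀ (by positivity)] at this
  nlinarith

lemma qe_dep {a b : ℝ} (hab : a ≤ b) {p q θ φ : ℝ → ℝ} {M ε : ℝ}
    (hM : ∀ x ∈ Icc a b, |p x| ≤ M) (hpq : ∀ x ∈ Icc a b, |p x - q x| ≤ ε)
    (hθ : ∀ x ∈ Icc a b, HasDerivWithinAt θ (qeF (p x) (θ x)) (Icc a b) x)
    (hφ : ∀ x ∈ Icc a b, HasDerivWithinAt φ (qeF (q x) (φ x)) (Icc a b) x)
    (h0 : θ a = φ a) :
    |θ b - φ b| ≤ ε * ((Real.exp (2 * (M + 1) * (b - a)) - 1) / (2 * (M + 1))) := by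
  have hM0 : 0 ≤ M := (abs_nonneg _).trans (hM a ⟨le_rfl, hab⟩)
  have := norm_le_gronwallBound_of_norm_deriv_right_le (a := a) (b := b)
    (f := fun x => θ x - φ x) (f' := fun x => qeF (p x) (θ x) - qeF (q x) (φ x))
    (δ := 0) (K := 2 * (M + 1)) (ε := ε)
    (fun y hy => ((hθ y hy).sub (hφ y hy)).continuousWithinAt)
    (fun y hy => qe_right hy ((hθ y (Ico_subset_Icc_self hy)).sub (hφ y (Ico_subset_Icc_self hy))))
    (by simp [h0]) ?_ b ⟨hab, le_rfl⟩
  · rw [gronwallBound_of_K_ne_0 (by positivity)] at this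
    simp only [Real.norm_eq_abs] at this
    convert this using 1
    ring
  · intro y hy
    have hy' := Ico_subset_Icc_self hy
    have e : qeF (p y) (θ y) - qeF (q y) (φ y)
      = (qeF (p y) (θ y) - qeF (p y) (φ y)) + (p y - q y) * Real.sin (φ y) ^ 2 := by
      rw [← qeF_q]; ring
    have h2 : |Real.sin (φ y) ^ 2| ≤ 1 := by
      rw [abs_of_nonneg (sq_nonneg _)]; exact Real.sin_sq_le_one _
    have h3 : |(p y - q y) * Real.sin (φ y) ^ 2| ≤ ε := by
      rw [abs_mul]
      have := mul_le_mul (hpq y hy') h2 (abs_nonneg _) ((abs_nonneg _).trans (hpq y hy'))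
      linarith
    simp only [Real.norm_eq_abs]
    rw [e]
    exact (abs_add_le _ _).trans (add_le_add (qeF_lip (hM y hy') _ _) h3)

/-- Rescaled angle. -/
noncomputable def qePsi (ω t : ℝ) : ℝ :=
  t + Real.arctan ((ω - 1) * (Real.sin t * Real.cos t) / (Real.cos t ^ 2 + ω * Real.sin t ^ 2))

lemma qePsi_near (ω t : ℝ) : |qePsi ω t - t| ≤ Real.pi / 2 := by
  unfold qePsi
  rw [add_sub_cancel_left, abs_le]
  exact ⟨(Real.neg_pi_div_two_lt_arctan _).le, (Real.arctan_lt_pi_div_two _).le⟩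

lemma qe_denpos {ω : ℝ} (hω : 0 < ω) (t : ℝ) : 0 < Real.cos t ^ 2 + ω * Real.sin t ^ 2 := by
  have h := Real.sin_sq_add_cos_sq t
  by_cases hc : Real.cos t = 0
  · rw [hc] at h ⊢
    have : Real.sin t ^ 2 = 1 := by nlinarith
    rw [this]; nlinarith
  · have := sq_nonneg (Real.sin t)
    positivity

lemma qePsi_deriv {ω : ℝ} (hω : 0 < ω) (t : ℝ) :
    HasDerivAt (qePsi ω) (ω / qeF (ω ^ 2) t) t := by
  have hD := qe_denpos hω t
  have hD2 := qe_denpos (pow_pos hω 2) t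
  have hs := Real.hasDerivAt_sin t
  have hc := Real.hasDerivAt_cos t
  have h := (hasDerivAt_id t).add ((((hs.mul hc).const_mul (ω - 1)).div
    ((hc.pow 2).add ((hs.pow 2).const_mul ω)) hD.ne').arctan)
  have hF : qeF (ω ^ 2) t = Real.cos t ^ 2 + ω ^ 2 * Real.sin t ^ 2 := by
    unfold qeF
    linarith [Real.sin_sq_add_cos_sq t]
  rw [hF]
  refine HasDerivAt.congr_deriv h ?_
  simp only [Pi.add_apply, Pi.mul_apply, Pi.pow_apply, Pi.div_apply]
  have e := Real.sin_sq_add_cos_sq t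
  generalize Real.sin t = s at *
  generalize Real.cos t = c at *
  have e1 : 1 + ((ω - 1) * (s * c) / (c ^ 2 + ω * s ^ 2)) ^ 2
      = (c ^ 2 + ω ^ 2 * s ^ 2) / (c ^ 2 + ω * s ^ 2) ^ 2 := by
    rw [eq_div_iff (by positivity), add_mul, div_pow, div_mul_cancel₀ _ (by positivity)]
    have : c ^ 2 + ω ^ 2 * s ^ 2 = (c ^ 2 + ω ^ 2 * s ^ 2) * (s ^ 2 + c ^ 2) := by rw [e, mul_one]
    rw [this]; ring
  rw [e1]
  have e2 : ((ω - 1) * (c * c + s * -s) * (c ^ 2 + ω * s ^ 2) -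
      (ω - 1) * (s * c) * (((2:ℕ):ℝ) * c ^ (2 - 1) * -s + ω * (((2:ℕ):ℝ) * s ^ (2 - 1) * c)))
      = (ω - 1) * (c ^ 2 - ω * s ^ 2) := by
    have : (ω - 1) * (c ^ 2 - ω * s ^ 2) = (ω - 1) * (c ^ 2 - ω * s ^ 2) * (s ^ 2 + c ^ 2) := by
      rw [e, mul_one]
    rw [this]; push_cast; ring
  rw [e2]
  field_simp
  have : ω = ω * (s ^ 2 + c ^ 2) := by rw [e, mul_one]
  linear_combination ω * e

lemma qe_rot_lower {a b ω : ℝ} (hab : a ≤ b) (hω : 0 < ω) {q θ : ℝ → ℝ}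
    (hq : ∀ x ∈ Icc a b, ω ^ 2 ≤ q x)
    (hθ : ∀ x ∈ Icc a b, HasDerivWithinAt θ (qeF (q x) (θ x)) (Icc a b) x) :
    ω * (b - a) - Real.pi ≤ θ b - θ a := by
  have hm := qe_mono (a := a) (b := b) (f := fun x => qePsi ω (θ x) - ω * x)
    (f' := fun x => ω / qeF (ω ^ 2) (θ x) * qeF (q x) (θ x) - ω * 1) ?_ ?_
  · have := hm ⟨le_rfl, hab⟩ ⟨hab, le_rfl⟩ hab
    have h1 := abs_le.1 (qePsi_near ω (θ a))
    have h2 := abs_le.1 (qePsi_near ω (θ b))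
    linarith [h1.1, h1.2, h2.1, h2.2]
  · intro x hx
    exact ((qePsi_deriv hω _).comp_hasDerivWithinAt x (hθ x hx)).sub
      ((hasDerivWithinAt_id x _).const_mul ω)
  · intro x hx
    have h1 := qeF_mono (hq x hx) (θ x)
    have h2 : 0 < qeF (ω ^ 2) (θ x) := by
      have := qe_denpos (pow_pos hω 2) (θ x)
      unfold qeF
      linarith [Real.sin_sq_add_cos_sq (θ x)]
    have : ω ≤ ω / qeF (ω ^ 2) (θ x) * qeF (q x) (θ x) := by
      rw [div_mul_eq_mul_div, le_div_iff₀ h2]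
      exact mul_le_mul_of_nonneg_left h1 hω.le
    linarith

lemma qe_rot_upper {a b ω : ℝ} (hab : a ≤ b) (hω : 0 < ω) {q θ : ℝ → ℝ}
    (hq : ∀ x ∈ Icc a b, q x ≤ ω ^ 2)
    (hθ : ∀ x ∈ Icc a b, HasDerivWithinAt θ (qeF (q x) (θ x)) (Icc a b) x) :
    θ b - θ a ≤ ω * (b - a) + Real.pi := by
  have hm := qe_mono (a := a) (b := b) (f := fun x => ω * x - qePsi ω (θ x))
    (f' := fun x => ω * 1 - ω / qeF (ω ^ 2) (θ x) * qeF (q x) (θ x)) ?_ ?_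
  · have := hm ⟨le_rfl, hab⟩ ⟨hab, le_rfl⟩ hab
    have h1 := abs_le.1 (qePsi_near ω (θ a))
    have h2 := abs_le.1 (qePsi_near ω (θ b))
    linarith [h1.1, h1.2, h2.1, h2.2]
  · intro x hx
    exact ((hasDerivWithinAt_id x _).const_mul ω).sub
      ((qePsi_deriv hω _).comp_hasDerivWithinAt x (hθ x hx))
  · intro x hx
    have h1 := qeF_mono (hq x hx) (θ x)
    have h2 : 0 < qeF (ω ^ 2) (θ x) := by
      have := qe_denpos (pow_pos hω 2) (θ x)
      unfold qeF
      linarith [Real.sin_sq_add_cos_sq (θ x)]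
    have : ω / qeF (ω ^ 2) (θ x) * qeF (q x) (θ x) ≤ ω := by
      rw [div_mul_eq_mul_div, div_le_iff₀ h2]
      exact mul_le_mul_of_nonneg_left h1 hω.le
    linarith

lemma qe_agmon {a d μ : ℝ} (hd : 0 < d) (hμ : 1 ≤ μ) {v v' p : ℝ → ℝ}
    (hv : ∀ x ∈ Icc a (a + 2 * d), HasDerivWithinAt v (v' x) (Icc a (a + 2 * d)) x)
    (hv' : ∀ x ∈ Icc a (a + 2 * d), HasDerivWithinAt v' (p x * v x) (Icc a (a + 2 * d)) x)
    (hp : ∀ x ∈ Icc a (a + 2 * d), μ ^ 2 ≤ p x) (h0 : v a = 0) :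
    ∫ x in a..(a + d), (v' x ^ 2 + v x ^ 2) ≤
      8 / d ^ 2 * Real.exp (-(μ * d)) * ∫ x in a..(a + 2 * d), v x ^ 2 := by
  have hvc : ContinuousOn v (Icc a (a + 2 * d)) := fun x hx => (hv x hx).continuousWithinAt
  have hvc' : ContinuousOn v' (Icc a (a + 2 * d)) := fun x hx => (hv' x hx).continuousWithinAt
  have hz : ∀ x ∈ Icc a (a + 2 * d), HasDerivWithinAt (fun x => v x * v' x)
      (v' x * v' x + v x * (p x * v x)) (Icc a (a + 2 * d)) x :=
    fun x hx => (hv x hx).mul (hv' x hx)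
  have hpv : ∀ x ∈ Icc a (a + 2 * d), μ ^ 2 * v x ^ 2 ≤ v x * (p x * v x) := by
    intro x hx
    nlinarith [mul_le_mul_of_nonneg_right (hp x hx) (sq_nonneg (v x))]
  have hsub : Icc a (a + d) ⊆ Icc a (a + 2 * d) := Icc_subset_Icc_right (by linarith)
  -- step 1
  have s1 : ∫ x in a..(a + d), (v' x ^ 2 + v x ^ 2) ≤ v (a + d) * v' (a + d) := by
    have := intervalIntegral.integral_le_sub_of_hasDeriv_right_of_le (a := a) (b := a + d)
      (g := fun x => v x * v' x) (g' := fun x => v' x * v' x + v x * (p x * v x))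
      (φ := fun x => v' x ^ 2 + v x ^ 2) (by linarith)
      (((hvc.mul hvc').mono hsub)) ?_ ?_ ?_
    · simpa [h0] using this
    · intro x hx
      have hx2 : x ∈ Ico a (a + 2 * d) := ⟨hx.1.le, by linarith [hx.2]⟩
      exact (qe_right hx2 (hz x (Ico_subset_Icc_self hx2))).mono Ioi_subset_Ici_self
    · exact ((((hvc'.pow 2).add (hvc.pow 2)).mono hsub)).integrableOn_Icc
    · intro x hx
      have h1 := hpv x (hsub (Ioo_subset_Icc_self hx))
      have : v x ^ 2 ≤ μ ^ 2 * v x ^ 2 :=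
        le_mul_of_one_le_left (sq_nonneg _) (by nlinarith)
      nlinarith
  -- step 2
  have s2 : MonotoneOn (fun x => v x * v' x * Real.exp (-(2 * μ) * x)) (Icc a (a + 2 * d)) := by
    refine qe_mono (f' := fun x => (v' x * v' x + v x * (p x * v x)) * Real.exp (-(2 * μ) * x)
      + v x * v' x * (Real.exp (-(2 * μ) * x) * (-(2 * μ) * 1))) ?_ ?_
    · intro x hx
      exact (hz x hx).mul (((hasDerivAt_id x).const_mul (-(2 * μ))).exp.hasDerivWithinAt)
    · intro x hx
      have h1 := hpv x hx
      have h2 : 0 ≤ v' x * v' x + v x * (p x * v x) - 2 * μ * (v x * v' x) := by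
        nlinarith [sq_nonneg (v' x - μ * v x)]
      have := mul_nonneg h2 (Real.exp_pos (-(2 * μ) * x)).le
      linarith
  have hzb0 : 0 ≤ v (a + d) * v' (a + d) := by
    refine le_trans ?_ s1
    apply intervalIntegral.integral_nonneg (by linarith)
    intro x _; positivity
  set Z := v (a + d) * v' (a + d) with hZ
  clear_value Z
  -- step 3
  have s3 : ∀ x ∈ Icc (a + d + d / 2) (a + 2 * d), Z * Real.exp (μ * d) ≤ v x * v' x := by
    intro x hx
    have := s2 (a := a + d) ⟨by linarith, by linarith⟩ (b := x) ⟨by linarith [hx.1], hx.2⟩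
      (by linarith [hx.1])
    simp only [← hZ] at this
    have h2 : Z * Real.exp (-(2 * μ) * (a + d)) * Real.exp (2 * μ * x) ≤ v x * v' x := by
      have h3 := mul_le_mul_of_nonneg_right this (Real.exp_pos (2 * μ * x)).le
      rwa [mul_assoc (v x * v' x), ← Real.exp_add, show -(2 * μ) * x + 2 * μ * x = 0 by ring,
        Real.exp_zero, mul_one] at h3
    refine le_trans ?_ h2
    rw [mul_assoc, ← Real.exp_add]
    apply mul_le_mul_of_nonneg_left _ hzb0
    apply Real.exp_le_exp.2
    nlinarith [hx.1, mul_nonneg (by linarith : (0:ℝ) ≤ μ) (sub_nonneg.2 hx.1)]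
  -- step 4
  have s4 : ∀ x ∈ Icc (a + d + d / 2) (a + 2 * d),
      2 * (Z * Real.exp (μ * d)) * (x - (a + d + d / 2)) ≤ v x ^ 2 := by
    have hs : Icc (a + d + d / 2) (a + 2 * d) ⊆ Icc a (a + 2 * d) :=
      Icc_subset_Icc_left (by linarith)
    have hm := qe_mono (a := a + d + d / 2) (b := a + 2 * d)
      (f := fun x => v x * v x - 2 * (Z * Real.exp (μ * d)) * x)
      (f' := fun x => (v' x * v x + v x * v' x) - 2 * (Z * Real.exp (μ * d)) * 1) ?_ ?_
    · intro x hx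
      have := hm ⟨le_rfl, by linarith⟩ hx hx.1
      simp only at this
      nlinarith [mul_self_nonneg (v (a + d + d / 2))]
    · intro x hx
      exact (((hv x (hs hx)).mul (hv x (hs hx))).mono hs).sub
        ((hasDerivWithinAt_id x _).const_mul _)
    · intro x hx
      have := s3 x hx
      linarith
  -- step 5
  have s5 : Z * Real.exp (μ * d) * (d ^ 2 / 8) ≤ ∫ x in a..(a + 2 * d), v x ^ 2 := by
    have i1 : IntervalIntegrable (fun x => v x ^ 2) volume a (a + 2 * d) := by
      apply ContinuousOn.intervalIntegrable
      rw [uIcc_of_le (by linarith)]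
      exact hvc.pow 2
    have h1 : ∫ x in (a + d + 3 * d / 4)..(a + 2 * d), v x ^ 2
        ≤ ∫ x in a..(a + 2 * d), v x ^ 2 := by
      apply intervalIntegral.integral_mono_interval (by linarith) (by linarith) le_rfl _ i1
      exact Filter.Eventually.of_forall fun x => sq_nonneg _
    refine le_trans ?_ h1
    have h2 : ∫ x in (a + d + 3 * d / 4)..(a + 2 * d), (Z * Real.exp (μ * d) * (d / 2))
        ≤ ∫ x in (a + d + 3 * d / 4)..(a + 2 * d), v x ^ 2 := by
      apply intervalIntegral.integral_mono_on (by linarith) (by simp)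
      · apply i1.mono_set
        rw [uIcc_of_le (by linarith), uIcc_of_le (by linarith)]
        exact Icc_subset_Icc_left (by linarith)
      · intro x hx
        refine le_trans ?_ (s4 x ⟨by linarith [hx.1], hx.2⟩)
        have : 0 ≤ Z * Real.exp (μ * d) := mul_nonneg hzb0 (Real.exp_pos _).le
        nlinarith [mul_nonneg this (sub_nonneg.2 hx.1)]
    rw [intervalIntegral.integral_const, smul_eq_mul] at h2
    refine le_trans (le_of_eq ?_) h2
    ring
  refine s1.trans ?_
  have : Z = 8 / d ^ 2 * Real.exp (-(μ * d)) * (Z * Real.exp (μ * d) * (d ^ 2 / 8)) := by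
    have : Real.exp (-(μ * d)) * Real.exp (μ * d) = 1 := by rw [← Real.exp_add]; simp
    have h8 : 8 / d ^ 2 * (d ^ 2 / 8) = 1 := by field_simp
    linear_combination (-Z) * this * (8 / d ^ 2 * (d ^ 2 / 8)) - Z * h8
  rw [this]
  exact mul_le_mul_of_nonneg_left s5 (by positivity)

lemma qe_amplitude {a b : ℝ} (hab : a < b) {q θ : ℝ → ℝ} (hq : ContinuousOn q (Icc a b))
    (hθ : ∀ x ∈ Icc a b, HasDerivWithinAt θ (qeF (q x) (θ x)) (Icc a b) x)
    (ha : Real.sin (θ a) = 0) (hb : Real.sin (θ b) = 0) :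
    ∃ u u' : ℝ → ℝ, (∀ x ∈ Icc a b, HasDerivWithinAt u (u' x) (Icc a b) x) ∧
      (∀ x ∈ Icc a b, HasDerivWithinAt u' (-q x * u x) (Icc a b) x) ∧
      (∃ x ∈ Icc a b, u x ≠ 0) ∧ u a = 0 ∧ u b = 0 := by
  have hθc : ContinuousOn θ (Icc a b) := fun x hx => (hθ x hx).continuousWithinAt
  have hg : ContinuousOn (fun x => (1 - q x) * (Real.sin (θ x) * Real.cos (θ x))) (Icc a b) := by
    fun_prop
  have hG : Continuous (IccExtend hab.le ((Icc a b).domRestrict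
      (fun x => (1 - q x) * (Real.sin (θ x) * Real.cos (θ x))))) :=
    (continuousOn_iff_continuous_domRestrict.1 hg).Icc_extend'
  obtain ⟨R, hR⟩ : ∃ R : ℝ → ℝ, ∀ x ∈ Icc a b, HasDerivWithinAt R
      ((1 - q x) * (Real.sin (θ x) * Real.cos (θ x))) (Icc a b) x := by
    refine ⟨fun x => ∫ t in a..x, IccExtend hab.le ((Icc a b).domRestrict
      (fun x => (1 - q x) * (Real.sin (θ x) * Real.cos (θ x)))) t, fun x hx => ?_⟩
    have := (hG.integral_hasStrictDerivAt a x).hasDerivAt.hasDerivWithinAt (s := Icc a b)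
    rwa [IccExtend_of_mem _ _ hx] at this
  have hu : ∀ x ∈ Icc a b, HasDerivWithinAt (fun x => Real.exp (R x) * Real.sin (θ x))
      (Real.exp (R x) * Real.cos (θ x)) (Icc a b) x := by
    intro x hx
    refine ((hR x hx).exp.mul (hθ x hx).sin).congr_deriv ?_
    unfold qeF
    linear_combination (0:ℝ) * Real.sin_sq_add_cos_sq (θ x)
  refine ⟨fun x => Real.exp (R x) * Real.sin (θ x), fun x => Real.exp (R x) * Real.cos (θ x),
    hu, ?_, ?_, ?_, ?_⟩
  · intro x hx
    refine ((hR x hx).exp.mul (hθ x hx).cos).congr_deriv ?_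
    unfold qeF
    linear_combination Real.exp (R x) * Real.sin (θ x) * (1 - q x) * Real.sin_sq_add_cos_sq (θ x)
  · by_contra hcon
    push Not at hcon
    have h1 : HasDerivWithinAt (fun x => Real.exp (R x) * Real.sin (θ x)) 0 (Icc a b) a := by
      refine (hasDerivWithinAt_const a (Icc a b) (0:ℝ)).congr (fun x hx => hcon x hx) ?_
      exact hcon a ⟨le_rfl, hab.le⟩
    have h2 := (uniqueDiffOn_Icc hab a ⟨le_rfl, hab.le⟩).eq_deriv _ h1 (hu a ⟨le_rfl, hab.le⟩)
    have h3 : Real.cos (θ a) = 0 := by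
      rcases mul_eq_zero.1 h2.symm with h | h
      · exact absurd h (Real.exp_pos _).ne'
      · exact h
    have := Real.sin_sq_add_cos_sq (θ a)
    rw [ha, h3] at this
    norm_num at this
  · simp [ha]
  · simp [hb]

lemma qe_agmon_right {b d μ : ℝ} (hd : 0 < d) (hμ : 1 ≤ μ) {v v' p : ℝ → ℝ}
    (hv : ∀ x ∈ Icc (b - 2 * d) b, HasDerivWithinAt v (v' x) (Icc (b - 2 * d) b) x)
    (hv' : ∀ x ∈ Icc (b - 2 * d) b, HasDerivWithinAt v' (p x * v x) (Icc (b - 2 * d) b) x)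
    (hp : ∀ x ∈ Icc (b - 2 * d) b, μ ^ 2 ≤ p x) (h0 : v b = 0) :
    ∫ x in (b - d)..b, (v' x ^ 2 + v x ^ 2) ≤
      8 / d ^ 2 * Real.exp (-(μ * d)) * ∫ x in (b - 2 * d)..b, v x ^ 2 := by
  have hm : ∀ x ∈ Icc (-b) (-b + 2 * d), -x ∈ Icc (b - 2 * d) b := by
    intro x hx
    exact ⟨by linarith [hx.2], by linarith [hx.1]⟩
  have := qe_agmon (a := -b) hd hμ (v := fun x => v (-x)) (v' := fun x => -v' (-x))
    (p := fun x => p (-x)) ?_ ?_ (fun x hx => hp _ (hm x hx)) (by simpa using h0)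
  · simp only [neg_sq] at this
    rw [intervalIntegral.integral_comp_neg (fun x => v' x ^ 2 + v x ^ 2),
      intervalIntegral.integral_comp_neg (fun x => v x ^ 2)] at this
    convert this using 3 <;> ring
  · intro x hx
    have := (hv _ (hm x hx)).scomp x (hasDerivAt_neg x).hasDerivWithinAt (fun y hy => hm y hy)
    simpa [Function.comp_def] using this
  · intro x hx
    have := ((hv' _ (hm x hx)).scomp x (hasDerivAt_neg x).hasDerivWithinAt
      (fun y hy => hm y hy)).neg
    simpa [Function.comp_def] using! this

lemma qe_shoot {a b κ₁ κ₂ M N y z ω₁ ω₂ : ℝ} (hab : a ≤ b) (hκ : κ₁ ≤ κ₂) {Q : ℝ → ℝ → ℝ}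
    (hQc : ∀ κ, ContinuousOn (Q κ) (Icc a b))
    (hM : ∀ κ ∈ Icc κ₁ κ₂, ∀ x ∈ Icc a b, |Q κ x| ≤ M)
    (hmono : ∀ x, Q κ₁ x ≤ Q κ₂ x)
    (hlip : ∀ κ κ' x, |Q κ x - Q κ' x| ≤ N * |κ - κ'|)
    (hay : a ≤ y) (hyz : y ≤ z) (hzb : z ≤ b) (hω₁ : 0 < ω₁) (hω₂ : 0 < ω₂)
    (h1 : ∀ x ∈ Icc y z, Q κ₁ x ≤ ω₁ ^ 2) (h2 : ∀ x ∈ Icc y z, ω₂ ^ 2 ≤ Q κ₂ x)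
    (hgap : 3 * Real.pi ≤ (ω₂ - ω₁) * (z - y)) :
    ∃ κ ∈ Icc κ₁ κ₂, ∃ θ : ℝ → ℝ, Real.sin (θ a) = 0 ∧ Real.sin (θ b) = 0 ∧
      ∀ x ∈ Icc a b, HasDerivWithinAt θ (qeF (Q κ x) (θ x)) (Icc a b) x := by
  have hex : ∀ κ ∈ Icc κ₁ κ₂, ∃ θ : ℝ → ℝ, θ a = 0 ∧
      ∀ x ∈ Icc a b, HasDerivWithinAt θ (qeF (Q κ x) (θ x)) (Icc a b) x :=
    fun κ hk => qe_exists hab (hQc κ) (hM κ hk)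
  choose! θ h0 hθ using hex
  have m1 : κ₁ ∈ Icc κ₁ κ₂ := ⟨le_rfl, hκ⟩
  have m2 : κ₂ ∈ Icc κ₁ κ₂ := ⟨hκ, le_rfl⟩
  have hcont : ContinuousOn (fun κ => θ κ b) (Icc κ₁ κ₂) := by
    set K := (Real.exp (2 * (M + 1) * (b - a)) - 1) / (2 * (M + 1)) with hK
    have hb : ∀ κ ∈ Icc κ₁ κ₂, ∀ κ' ∈ Icc κ₁ κ₂, |θ κ b - θ κ' b| ≤ N * |κ - κ'| * K := by
      intro κ hk κ' hk'
      exact qe_dep hab (hM κ hk) (fun x _ => hlip κ κ' x) (hθ κ hk) (hθ κ' hk')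
        (by rw [h0 κ hk, h0 κ' hk'])
    have : LipschitzOnWith (Real.toNNReal (N * K)) (fun κ => θ κ b) (Icc κ₁ κ₂) := by
      apply LipschitzOnWith.of_dist_le_mul
      intro κ hk κ' hk'
      rw [Real.dist_eq, Real.dist_eq]
      refine (hb κ hk κ' hk').trans ?_
      have := mul_le_mul_of_nonneg_right (Real.le_coe_toNNReal (N * K)) (abs_nonneg (κ - κ'))
      linarith
    exact this.continuousOn
  have c1 : θ κ₁ y ≤ θ κ₂ y :=
    qe_compare (hM κ₁ m1) (fun x _ => hmono x) (hθ κ₁ m1) (hθ κ₂ m2)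
      (by rw [h0 _ m1, h0 _ m2]) y ⟨hay, hyz.trans hzb⟩
  have sub1 : Icc y z ⊆ Icc a b := Icc_subset_Icc hay hzb
  have sub2 : Icc z b ⊆ Icc a b := Icc_subset_Icc_left (hay.trans hyz)
  have r1 := qe_rot_upper hyz hω₁ h1 (fun x hx => (hθ κ₁ m1 x (sub1 hx)).mono sub1)
  have r2 := qe_rot_lower hyz hω₂ h2 (fun x hx => (hθ κ₂ m2 x (sub1 hx)).mono sub1)
  have c2 : θ κ₁ z + Real.pi ≤ θ κ₂ z := by linarith
  have c3 : θ κ₁ b + Real.pi ≤ θ κ₂ b := by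
    refine qe_compare (a := z) (b := b) (θ := fun x => θ κ₁ x + Real.pi)
      (fun x hx => hM κ₁ m1 x (sub2 hx)) (fun x _ => hmono x) ?_
      (fun x hx => (hθ κ₂ m2 x (sub2 hx)).mono sub2) c2 b ⟨hzb, le_rfl⟩
    intro x hx
    have := ((hθ κ₁ m1 x (sub2 hx)).mono sub2).add_const Real.pi
    refine this.congr_deriv ?_
    unfold qeF
    rw [Real.sin_add_pi]; ring
  have hk1 := Int.le_ceil (θ κ₁ b / Real.pi)
  have hk2 := (Int.ceil_lt_add_one (θ κ₁ b / Real.pi)).le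
  rw [div_le_iff₀ Real.pi_pos] at hk1
  have hk2' : (⌈θ κ₁ b / Real.pi⌉ : ℝ) * Real.pi ≤ θ κ₂ b := by
    have := mul_le_mul_of_nonneg_right hk2 Real.pi_pos.le
    rw [add_mul, div_mul_cancel₀ _ Real.pi_pos.ne'] at this
    linarith
  obtain ⟨κ, hk, hkb⟩ := intermediate_value_Icc hκ hcont ⟨hk1, hk2'⟩
  refine ⟨κ, hk, θ κ, by rw [h0 κ hk, Real.sin_zero], ?_, hθ κ hk⟩
  simp only at hkb
  rw [hkb, Real.sin_int_mul_pi]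

set_option maxHeartbeats 2000000

/-- Lemma 4.5 of the paper, one-dimensional reduced form: with `h_ℓ⁻² = ℓ(ℓ+1)` and an
effective potential `V₀ + h_ℓ² W` such that `V₀` dips below `E − δ` inside `[x₁,x₂]` but
exceeds `E + δ` by `c'` on the boundary strips, for every sufficiently large `ℓ` there
is a Dirichlet eigenfunction `u_ℓ` with eigenvalue `κ_ℓ ∈ [E−δ, E+δ]` which is
exponentially suppressed (in `√(ℓ(ℓ+1))`) in the strips of width `δ'` near the
boundary. These are the eigenfunctions underlying the quasimode construction. -/
theorem quasimode_eigenfunctions_exist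
    (x₁ x₂ : ℝ) (hx : x₁ < x₂)
    (V₀ W : ℝ → ℝ)
    (hV₀cont : ContinuousOn V₀ (Icc x₁ x₂))
    (hWcont : ContinuousOn W (Icc x₁ x₂))
    (hV₀pos : ∀ x ∈ Icc x₁ x₂, 0 < V₀ x)
    (E δ δ' c' : ℝ)
    (hδ : 0 < δ) (hδE : δ < E)
    (hδ' : 0 < δ') (hδ'lt : δ' < (x₂ - x₁) / 4)
    (hc' : 0 < c')
    (hmin : ∃ x ∈ Icc x₁ x₂, V₀ x < E - δ)
    (hbarrier : ∀ x, x ∈ Icc x₁ (x₁ + 2 * δ') ∪ Icc (x₂ - 2 * δ') x₂ →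
        c' ≤ V₀ x - (E + δ)) :
    ∃ C : ℝ, ∃ L : ℕ, 0 < C ∧ 0 < L ∧
      ∀ ℓ : ℕ, L ≤ ℓ →
        ∃ κ ∈ Icc (E - δ) (E + δ), ∃ u u' u'' : ℝ → ℝ,
          (∀ x ∈ Icc x₁ x₂, HasDerivWithinAt u (u' x) (Icc x₁ x₂) x) ∧
          (∀ x ∈ Icc x₁ x₂, HasDerivWithinAt u' (u'' x) (Icc x₁ x₂) x) ∧
          ContinuousOn u'' (Icc x₁ x₂) ∧
          (∃ x ∈ Icc x₁ x₂, u x ≠ 0) ∧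
          u x₁ = 0 ∧ u x₂ = 0 ∧
          (∀ x ∈ Icc x₁ x₂,
            -((ℓ : ℝ) * (ℓ + 1))⁻¹ * u'' x
              + (V₀ x + ((ℓ : ℝ) * (ℓ + 1))⁻¹ * W x) * u x = κ * u x) ∧
          (∫ x in x₁..(x₁ + δ'), ((u' x) ^ 2 + (u x) ^ 2))
              + (∫ x in (x₂ - δ')..x₂, ((u' x) ^ 2 + (u x) ^ 2))
            ≤ C * Real.exp (-C * Real.sqrt ((ℓ : ℝ) * (ℓ + 1)))
                * ∫ x in x₁..x₂, (u x) ^ 2 := by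
  obtain ⟨xm, hxm, hVm⟩ := hmin
  obtain ⟨B₀, hB₀⟩ := isCompact_Icc.exists_bound_of_continuousOn hWcont
  obtain ⟨BV, hBV⟩ := isCompact_Icc.exists_bound_of_continuousOn hV₀cont
  have hxm2 : xm < x₂ := by
    rcases hxm.2.lt_or_eq with h | h
    · exact h
    · have := hbarrier x₂ (Or.inr ⟨by linarith, le_rfl⟩)
      rw [h] at hVm
      linarith
  obtain ⟨η, hη, hηV⟩ := Metric.continuousWithinAt_iff.1 (hV₀cont xm hxm) (δ / 4) (by linarith)
  obtain ⟨z, hz1, hz2, hzV⟩ : ∃ z, xm < z ∧ z ≤ x₂ ∧ ∀ x ∈ Icc xm z, |V₀ x - V₀ xm| ≤ δ / 4 := by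
    refine ⟨min (xm + η / 2) x₂, lt_min (by linarith) hxm2, min_le_right _ _, ?_⟩
    intro x hx
    have hx2 : x ≤ xm + η / 2 := hx.2.trans (min_le_left _ _)
    have := hηV (x := x) ⟨hxm.1.trans hx.1, hx.2.trans (min_le_right _ _)⟩ (by
      rw [Real.dist_eq, abs_of_nonneg (by linarith [hx.1])]; linarith)
    rw [Real.dist_eq] at this
    exact this.le
  set β := E - V₀ xm with hβ
  have hβδ : δ < β := by linarith
  set g := Real.sqrt (β + δ / 2) - Real.sqrt (β - δ / 2) with hg
  have hg0 : 0 < g := sub_pos.2 (Real.sqrt_lt_sqrt (by linarith) (by linarith))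
  set ρ := Real.sqrt (c' / 2) * δ' with hρ
  have hρ0 : 0 < ρ := mul_pos (Real.sqrt_pos.2 (by linarith)) hδ'
  have hN : Filter.Tendsto (fun ℓ : ℕ => (ℓ : ℝ) * (ℓ + 1)) Filter.atTop Filter.atTop := by
    refine Filter.tendsto_atTop_mono (f := fun ℓ : ℕ => (ℓ : ℝ)) ?_ tendsto_natCast_atTop_atTop
    intro n
    have : (0:ℝ) ≤ n := Nat.cast_nonneg n
    nlinarith
  have hS : Filter.Tendsto (fun ℓ : ℕ => Real.sqrt ((ℓ : ℝ) * (ℓ + 1))) Filter.atTop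
      Filter.atTop := Real.tendsto_sqrt_atTop.comp hN
  have hexp : Filter.Tendsto (fun ℓ : ℕ => 16 / δ' ^ 2 *
      Real.exp (-(ρ / 2 * Real.sqrt ((ℓ : ℝ) * (ℓ + 1))))) Filter.atTop (nhds (16 / δ' ^ 2 * 0)) :=
    ((Real.tendsto_exp_neg_atTop_nhds_zero.comp
      (hS.const_mul_atTop (by linarith : 0 < ρ / 2)))).const_mul _
  rw [mul_zero] at hexp
  have hev := (hN.eventually_gt_atTop 0).and <| (hN.eventually_ge_atTop (4 * B₀ / δ)).and <|
    (hN.eventually_ge_atTop (2 * B₀ / c')).and <| (hN.eventually_ge_atTop (2 / c')).and <|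
    (hS.eventually_ge_atTop (3 * Real.pi / (g * (z - xm)))).and <|
    (hexp.eventually_le_const (by linarith : 0 < ρ / 2))
  obtain ⟨L, hL⟩ := Filter.eventually_atTop.1 hev
  refine ⟨ρ / 2, L + 1, by linarith, by omega, ?_⟩
  intro ℓ hℓ
  obtain ⟨hN0, hN1, hN2, hN3, hN4, hN5⟩ := hL ℓ (by omega)
  set N : ℝ := (ℓ : ℝ) * (ℓ + 1) with hNdef
  clear_value N
  set S := Real.sqrt N with hSdef
  have hS0 : 0 < S := Real.sqrt_pos.2 hN0
  have hSS : S ^ 2 = N := Real.sq_sqrt hN0.le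
  rw [div_le_iff₀ hδ] at hN1
  rw [div_le_iff₀ hc'] at hN2 hN3
  have hzx : 0 < z - xm := by linarith
  rw [div_le_iff₀ (by positivity)] at hN4
  have hW : ∀ x ∈ Icc x₁ x₂, -B₀ ≤ W x ∧ W x ≤ B₀ := fun x hx => abs_le.1 (hB₀ x hx)
  have hVb : ∀ x ∈ Icc x₁ x₂, -BV ≤ V₀ x ∧ V₀ x ≤ BV := fun x hx => abs_le.1 (hBV x hx)
  have subJ : Icc xm z ⊆ Icc x₁ x₂ := Icc_subset_Icc hxm.1 hz2
  obtain ⟨κ, hκ, θ, hθa, hθb, hθ⟩ := qe_shoot (a := x₁) (b := x₂) (κ₁ := E - δ) (κ₂ := E + δ)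
    (M := N * (E + δ + BV) + B₀) (N := N) (y := xm) (z := z)
    (ω₁ := Real.sqrt (β - δ / 2) * S) (ω₂ := Real.sqrt (β + δ / 2) * S) hx.le (by linarith)
    (Q := fun κ x => N * (κ - V₀ x) - W x)
    (fun κ => by fun_prop)
    (by
      intro κ hκ x hx
      have h1 := hW x hx
      have h2 := hVb x hx
      rw [abs_le]
      constructor
      · nlinarith [mul_nonneg hN0.le (by linarith [hκ.1] : 0 ≤ κ + E + δ + BV - V₀ x)]
      · nlinarith [mul_nonneg hN0.le (by linarith [hκ.2] : 0 ≤ E + δ + BV - κ + V₀ x)])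
    (fun x => by nlinarith)
    (fun κ κ' x => by
      rw [show N * (κ - V₀ x) - W x - (N * (κ' - V₀ x) - W x) = N * (κ - κ') by ring, abs_mul,
        abs_of_pos hN0])
    hxm.1 hz1.le hz2
    (mul_pos (Real.sqrt_pos.2 (by linarith)) hS0) (mul_pos (Real.sqrt_pos.2 (by linarith)) hS0)
    (by
      intro x hx
      rw [mul_pow, hSS, Real.sq_sqrt (by linarith)]
      have h1 := hW x (subJ hx)
      have h2 := abs_le.1 (hzV x hx)
      nlinarith [mul_nonneg hN0.le (by linarith [h2.1] : 0 ≤ δ / 4 + V₀ x - V₀ xm)])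
    (by
      intro x hx
      rw [mul_pow, hSS, Real.sq_sqrt (by linarith)]
      have h1 := hW x (subJ hx)
      have h2 := abs_le.1 (hzV x hx)
      nlinarith [mul_nonneg hN0.le (by linarith [h2.2] : 0 ≤ δ / 4 - V₀ x + V₀ xm)])
    (by
      rw [← sub_mul, ← hg]
      linarith)
  have hQc : ContinuousOn (fun x => N * (κ - V₀ x) - W x) (Icc x₁ x₂) := by fun_prop
  obtain ⟨u, u', hu, hu', hne, hu1, hu2⟩ := qe_amplitude hx hQc hθ hθa hθb
  have huc : ContinuousOn u (Icc x₁ x₂) := fun x hx => (hu x hx).continuousWithinAt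
  refine ⟨κ, hκ, u, u', fun x => -(N * (κ - V₀ x) - W x) * u x, hu, hu', hQc.neg.mul huc, hne,
    hu1, hu2, ?_, ?_⟩
  · intro x _
    field_simp
    ring
  set μ := Real.sqrt (c' / 2) * S with hμdef
  have hμ2 : μ ^ 2 = c' / 2 * N := by rw [hμdef, mul_pow, hSS, Real.sq_sqrt (by linarith)]
  have hμ0 : 0 < μ := mul_pos (Real.sqrt_pos.2 (by linarith)) hS0
  have hμ1 : 1 ≤ μ := by
    by_contra h
    push Not at h
    nlinarith
  have hμδ : μ * δ' = ρ * S := by rw [hμdef, hρ]; ring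
  have hp : ∀ x ∈ Icc x₁ x₂, c' ≤ V₀ x - (E + δ) → μ ^ 2 ≤ -(N * (κ - V₀ x) - W x) := by
    intro x hx hb
    have h1 := hW x hx
    rw [hμ2]
    nlinarith [mul_nonneg hN0.le (by linarith [hκ.2] : 0 ≤ V₀ x - κ - c')]
  have subL : Icc x₁ (x₁ + 2 * δ') ⊆ Icc x₁ x₂ := Icc_subset_Icc_right (by linarith)
  have subR : Icc (x₂ - 2 * δ') x₂ ⊆ Icc x₁ x₂ := Icc_subset_Icc_left (by linarith)
  have aL := qe_agmon (a := x₁) hδ' hμ1 (v := u) (v' := u')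
    (p := fun x => -(N * (κ - V₀ x) - W x))
    (fun x hx => (hu x (subL hx)).mono subL) (fun x hx => (hu' x (subL hx)).mono subL)
    (fun x hx => hp x (subL hx) (hbarrier x (Or.inl hx))) hu1
  have aR := qe_agmon_right (b := x₂) hδ' hμ1 (v := u) (v' := u')
    (p := fun x => -(N * (κ - V₀ x) - W x))
    (fun x hx => (hu x (subR hx)).mono subR) (fun x hx => (hu' x (subR hx)).mono subR)
    (fun x hx => hp x (subR hx) (hbarrier x (Or.inr hx))) hu2
  have i1 : IntervalIntegrable (fun x => u x ^ 2) volume x₁ x₂ := by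
    apply ContinuousOn.intervalIntegrable
    rw [uIcc_of_le hx.le]
    exact huc.pow 2
  have iL : ∫ x in x₁..(x₁ + 2 * δ'), u x ^ 2 ≤ ∫ x in x₁..x₂, u x ^ 2 := by
    apply intervalIntegral.integral_mono_interval le_rfl (by linarith) (by linarith) _ i1
    exact Filter.Eventually.of_forall fun x => sq_nonneg _
  have iR : ∫ x in (x₂ - 2 * δ')..x₂, u x ^ 2 ≤ ∫ x in x₁..x₂, u x ^ 2 := by
    apply intervalIntegral.integral_mono_interval (by linarith) (by linarith) le_rfl _ i1
    exact Filter.Eventually.of_forall fun x => sq_nonneg _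
  have i0 : 0 ≤ ∫ x in x₁..x₂, u x ^ 2 :=
    intervalIntegral.integral_nonneg hx.le fun x _ => sq_nonneg _
  rw [hμδ] at aL aR
  have hk : 0 ≤ 8 / δ' ^ 2 * Real.exp (-(ρ * S)) := by positivity
  have aL' := aL.trans (mul_le_mul_of_nonneg_left iL hk)
  have aR' := aR.trans (mul_le_mul_of_nonneg_left iR hk)
  have hfin : 16 / δ' ^ 2 * Real.exp (-(ρ * S)) ≤ ρ / 2 * Real.exp (-(ρ / 2) * S) := by
    have e : Real.exp (-(ρ * S)) = Real.exp (-(ρ / 2 * S)) * Real.exp (-(ρ / 2) * S) := by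
      rw [← Real.exp_add]; congr 1; ring
    rw [e, ← mul_assoc]
    exact mul_le_mul_of_nonneg_right hN5 (Real.exp_pos _).le
  have := mul_le_mul_of_nonneg_right hfin i0
  refine le_trans ?_ this
  have e16 : 16 / δ' ^ 2 = 8 / δ' ^ 2 + 8 / δ' ^ 2 := by ring
  rw [e16]
  linarith
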